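/- Let l > 0, L > 0 and let f : [−l, l] → ℝ^m be Lipschitz continuous with Lipschitz constant at most L. If sup_{s ∈ [−l,l]} |f(s)| ≤ 2 L l, then (sup_{s ∈ [−l,l]} |f(s)|)³ ≤ 4 L ∫_{−l}^{l} |f(s)|² ds. In particular, for maps f with Lipschitz constant 2K₀ and sup |f| ≤ 4K₀l, one gets ‖f‖_{L^∞([−l,l])} ≤ C₂ ‖f‖_{L²([−l,l])}^{2/3} with C₂ = (8K₀)^{1/3} depending only on K₀ and not on l. (Quantitative form of Lemma 2.4.) -/

import Mathlib

noncomputable section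

open MeasureTheory Real Set

/-- If a nonconstant affine function is nonnegative on `[a, b]` and bounded there by `g`, then the
integral of its square bounds that of `g ^ 2` from below. -/
theorem affine_cube_sub_le_integral_sq {g : ℝ → ℝ} {a b p k : ℝ} (hab : a ≤ b) (hk : k ≠ 0)
    (hg : ContinuousOn g (Icc a b))
    (h : ∀ s ∈ Icc a b, 0 ≤ p + k * s ∧ p + k * s ≤ g s) :
    ((p + k * b) ^ 3 - (p + k * a) ^ 3) / (3 * k) ≤ ∫ s in a..b, g s ^ 2 := by
  have hderiv : ∀ s ∈ uIcc a b,
      HasDerivAt (fun s => (p + k * s) ^ 3 / (3 * k)) ((p + k * s) ^ 2) s := by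
    intro s _
    have h1 : HasDerivAt (fun s : ℝ => p + k * s) k s := by
      simpa using ((hasDerivAt_id s).const_mul k).const_add p
    refine ((h1.pow 3).div_const (3 * k)).congr_deriv ?_
    field_simp
    norm_num [mul_comm]
  have hint : IntervalIntegrable (fun s => (p + k * s) ^ 2) volume a b :=
    Continuous.intervalIntegrable (by fun_prop) a b
  rw [sub_div, ← intervalIntegral.integral_eq_sub_of_hasDerivAt hderiv hint]
  refine intervalIntegral.integral_mono_on hab hint ?_ fun s hs =>
    pow_le_pow_left₀ (h s hs).1 (h s hs).2 2
  exact ContinuousOn.intervalIntegrable (by rw [uIcc_of_le hab]; exact hg.pow 2)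

/-- A continuous function lying above a cone of height `M` and slope `L` with vertex in `[-l, l]`
satisfies `M ^ 3 ≤ 4 * L * ∫ g ^ 2`, provided the interval has length at least `M / L`. -/
theorem cube_le_integral_sq {g : ℝ → ℝ} {l L M t : ℝ} (hL : 0 < L) (hM : 0 ≤ M)
    (hMl : M ≤ 2 * L * l) (ht : t ∈ Icc (-l) l) (hg : ContinuousOn g (Icc (-l) l))
    (h : ∀ s ∈ Icc (-l) l, M - L * |s - t| ≤ g s) :
    M ^ 3 ≤ 4 * L * ∫ s in Ioo (-l) l, g s ^ 2 := by
  obtain ⟨c, d, hlc, hct, htd, hdl, hcd⟩ :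
      ∃ c d, -l ≤ c ∧ c ≤ t ∧ t ≤ d ∧ d ≤ l ∧ L * (d - c) = M := by
    have hr : L * (M / L) = M := by field_simp
    have hr0 : 0 ≤ M / L := by positivity
    have hrl : M / L ≤ 2 * l := by
      rw [div_le_iff₀ hL]
      linarith
    rcases le_total (-l) (t - M / L) with hc | hc
    · exact ⟨t - M / L, t, hc, by linarith, le_rfl, ht.2, by rw [sub_sub_cancel, hr]⟩
    · exact ⟨-l, -l + M / L, le_rfl, ht.1, by linarith, by linarith,
        by rw [add_sub_cancel_left, hr]⟩
  have hleft := affine_cube_sub_le_integral_sq (p := M - L * t) hct hL.ne'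
    (hg.mono (Icc_subset_Icc hlc ht.2)) fun s hs => by
      have h1 := h s ⟨hlc.trans hs.1, hs.2.trans ht.2⟩
      rw [abs_of_nonpos (by linarith [hs.2])] at h1
      exact ⟨by nlinarith [hs.1], by linarith⟩
  have hright := affine_cube_sub_le_integral_sq (p := M + L * t) htd (neg_ne_zero.mpr hL.ne')
    (hg.mono (Icc_subset_Icc ht.1 hdl)) fun s hs => by
      have h1 := h s ⟨ht.1.trans hs.1, hs.2.trans hdl⟩
      rw [abs_of_nonneg (by linarith [hs.1])] at h1
      exact ⟨by nlinarith [hs.2], by linarith⟩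
  have hi : ∀ {a b : ℝ}, -l ≤ a → a ≤ b → b ≤ l →
      IntervalIntegrable (fun s => g s ^ 2) volume a b := fun ha hab hb =>
    ContinuousOn.intervalIntegrable <| by
      rw [uIcc_of_le hab]
      exact (hg.mono (Icc_subset_Icc ha hb)).pow 2
  have hsplit := intervalIntegral.integral_add_adjacent_intervals
    (hi hlc hct ht.2) (hi ht.1 htd hdl)
  have hmono : ∫ s in c..d, g s ^ 2 ≤ ∫ s in (-l)..l, g s ^ 2 :=
    intervalIntegral.integral_mono_interval hlc (hct.trans htd) hdl
      (Filter.Eventually.of_forall fun s => sq_nonneg (g s))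
      (hi le_rfl (ht.1.trans ht.2) le_rfl)
  rw [← integral_Ioc_eq_integral_Ioo, ← intervalIntegral.integral_of_le (ht.1.trans ht.2)]
  rw [div_le_iff₀ (by linarith)] at hleft
  rw [div_le_iff_of_neg (by linarith)] at hright
  have hx : 0 ≤ L * (t - c) := mul_nonneg hL.le (by linarith)
  have hy : 0 ≤ L * (d - t) := mul_nonneg hL.le (by linarith)
  have hcube : (L * (d - t)) ^ 3 + (L * (t - c)) ^ 3 ≤ M ^ 3 := by
    rw [← hcd]
    have hsum : L * (d - c) = L * (d - t) + L * (t - c) := by ring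
    rw [hsum]
    nlinarith [mul_nonneg (mul_nonneg hx hy) (add_nonneg hx hy)]
  have e1 : M - L * t + L * c = L * (d - t) := by rw [← hcd]; ring
  have e2 : M + L * t + -L * d = L * (t - c) := by rw [← hcd]; ring
  rw [e1, show M - L * t + L * t = M by ring] at hleft
  rw [e2, show M + L * t + -L * t = M by ring] at hright
  have hpos : 0 ≤ ∫ s in (-l)..l, g s ^ 2 :=
    intervalIntegral.integral_nonneg (ht.1.trans ht.2) fun s _ => sq_nonneg (g s)
  nlinarith [mul_le_mul_of_nonneg_left hmono hL.le, mul_nonneg hL.le hpos]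

/-- quantitative form of Lemma 2.4: if `f : [-l, l] → ℝ^m` is
`L`-Lipschitz and `sup |f| ≤ 2Ll`, then `(sup |f|)³ ≤ 4L ∫ |f|²`; in particular for
`L = 2K₀` one gets `‖f‖_∞ ≤ (8K₀)^{1/3} ‖f‖_{L²}^{2/3}`. -/
theorem statement8 (m : ℕ) (l L : ℝ) (hl : 0 < l) (hL : 0 < L)
    (f : ℝ → EuclideanSpace ℝ (Fin m))
    (hlip : LipschitzOnWith (Real.toNNReal L) f (Set.Icc (-l) l))
    (hsup : ∀ s ∈ Set.Icc (-l) l, ‖f s‖ ≤ 2 * L * l) :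
    (sSup ((fun s => ‖f s‖) '' Set.Icc (-l) l)) ^ 3
        ≤ 4 * L * ∫ s in Set.Ioo (-l) l, ‖f s‖ ^ 2 ∧
      ∀ K₀ : ℝ, 0 < K₀ → L = 2 * K₀ →
        sSup ((fun s => ‖f s‖) '' Set.Icc (-l) l)
          ≤ (8 * K₀) ^ ((1 : ℝ) / 3) * (∫ s in Set.Ioo (-l) l, ‖f s‖ ^ 2) ^ ((1 : ℝ) / 3) := by
  have hcont : ContinuousOn (fun s => ‖f s‖) (Icc (-l) l) := hlip.continuousOn.norm
  obtain ⟨t, ht, hsSup, -⟩ :=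
    isCompact_Icc.exists_sSup_image_eq_and_ge (nonempty_Icc.mpr (by linarith)) hcont
  have hmain : ‖f t‖ ^ 3 ≤ 4 * L * ∫ s in Ioo (-l) l, ‖f s‖ ^ 2 := by
    refine cube_le_integral_sq hL (norm_nonneg _) (hsup t ht) ht hcont fun s hs => ?_
    have h1 := hlip.dist_le_mul s hs t ht
    rw [Real.coe_toNNReal L hL.le, dist_eq_norm, Real.dist_eq, norm_sub_rev] at h1
    linarith [norm_sub_norm_le (f t) (f s)]
  rw [hsSup]
  refine ⟨hmain, fun K₀ hK₀ hLK => ?_⟩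
  have hint : 0 ≤ ∫ s in Ioo (-l) l, ‖f s‖ ^ 2 := integral_nonneg fun s => sq_nonneg _
  have hcube : ‖f t‖ ^ 3 ≤ 8 * K₀ * ∫ s in Ioo (-l) l, ‖f s‖ ^ 2 :=
    hmain.trans_eq (by rw [hLK]; ring)
  generalize ∫ s in Ioo (-l) l, ‖f s‖ ^ 2 = I at hint hcube ⊢
  rw [← Real.mul_rpow (by positivity) hint, one_div,
    Real.le_rpow_inv_iff_of_pos (norm_nonneg _) (by positivity) (by norm_num)]
  exact_mod_cast hcube
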